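/- arXiv:2101.08356 — 2 statements merged into one kernel-verified Lean document; each statement's English description precedes it below -/
import Mathlib

section
/- Suppose b ≥ √2, and set μ = √3·b. Then the function h(t) = |δ̇_b(t)| + μ·|δ_b(t) − 1| satisfies h(t) ≤ t·b² + μ·∫₀ᵗ h(s) ds for all t ≥ 0, and consequently h(t) ≤ (b²/μ)·(e^{μt} − 1) for all t ≥ 0. In particular, δ_b(t) ≥ 0 whenever 0 ≤ t ≤ (log 4)/(√3·b). -/
noncomputable section

/-- `y` solves the ODE `y'' + (2/t) y' + (y^3 - y) = 0` on `(0,∞)` with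
`y(0) = b`, `y'(0) = 0`. -/
def IsSolution (b : ℝ) (y : ℝ → ℝ) : Prop :=
  y 0 = b ∧ deriv y 0 = 0 ∧
  (∀ t : ℝ, 0 ≤ t → DifferentiableAt ℝ y t) ∧
  (∀ t : ℝ, 0 < t → DifferentiableAt ℝ (deriv y) t) ∧
  ∀ t : ℝ, 0 < t →
    deriv (deriv y) t + (2 / t) * deriv y t + ((y t) ^ 3 - y t) = 0

/-- The energy `E(t) = (1/2) y'(t)^2 + (1/4) y(t)^4 - (1/2) y(t)^2`. -/
def energy (y : ℝ → ℝ) (t : ℝ) : ℝ :=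
  (1 / 2) * (deriv y t) ^ 2 + (1 / 4) * (y t) ^ 4 - (1 / 2) * (y t) ^ 2

/-- `δ` solves the equation of variation along `y`. -/
def IsVariation (y δ : ℝ → ℝ) : Prop :=
  δ 0 = 1 ∧ deriv δ 0 = 0 ∧
  (∀ t : ℝ, 0 ≤ t → DifferentiableAt ℝ δ t) ∧
  (∀ t : ℝ, 0 < t → DifferentiableAt ℝ (deriv δ) t) ∧
  ∀ t : ℝ, 0 < t →
    deriv (deriv δ) t + (2 / t) * deriv δ t + (3 * (y t) ^ 2 - 1) * δ t = 0

open Set Filter Topology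

lemma continuous_comp_max_zero {f : ℝ → ℝ} (hf : ContinuousOn f (Ici 0)) :
    Continuous fun s : ℝ => f (max s 0) :=
  hf.comp_continuous (by fun_prop) fun s => le_max_right s 0

/-- Integrated form of the radial equation `u'' + (2/t) u' + g = 0`: differentiability of `u` at
the origin excludes the singular solutions. -/
lemma sq_mul_deriv_eq_neg_integral {u g : ℝ → ℝ} (hg : Continuous g)
    (hu : ∀ t : ℝ, 0 ≤ t → DifferentiableAt ℝ u t)
    (hu' : ∀ t : ℝ, 0 < t → DifferentiableAt ℝ (deriv u) t)
    (hode : ∀ t : ℝ, 0 < t → deriv (deriv u) t + (2 / t) * deriv u t + g t = 0)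
    {t : ℝ} (ht : 0 ≤ t) :
    t ^ 2 * deriv u t = -∫ s in (0 : ℝ)..t, s ^ 2 * g s := by
  set I : ℝ → ℝ := fun t => ∫ s in (0 : ℝ)..t, s ^ 2 * g s with hI
  have hcont : Continuous fun s : ℝ => s ^ 2 * g s := by fun_prop
  have hId : ∀ t, HasDerivAt I (t ^ 2 * g t) t := fun t =>
    hcont.integral_hasStrictDerivAt 0 t |>.hasDerivAt
  have hIc : Continuous I := continuous_iff_continuousAt.2 fun t => (hId t).continuousAt
  set P : ℝ → ℝ := fun t => t ^ 2 * deriv u t + I t with hP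
  have hPd : ∀ t, 0 < t → HasDerivAt P 0 t := by
    intro t ht
    have h := (((hasDerivAt_id t).pow 2).mul (hu' t ht).hasDerivAt).add (hId t)
    refine h.congr_deriv ?_
    have h0 := hode t ht
    have : deriv (deriv u) t = -(2 / t) * deriv u t - g t := by linarith
    simp only [this, id]
    simp
    field_simp
    ring
  have hPc : ∀ s, 0 < s → P s = P 1 := by
    intro s hs
    refine (convex_Ioi (0 : ℝ)).is_const_of_fderivWithin_eq_zero (𝕜 := ℝ)
      (fun x hx => (hPd x hx).differentiableAt.differentiableWithinAt) ?_ hs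
      (mem_Ioi.2 one_pos)
    intro x hx
    rw [fderivWithin_of_isOpen isOpen_Ioi hx]
    ext
    simp [(hPd x hx).deriv]
  have hmvt : ∀ s : ℝ, ∃ ξ, 0 < s → (0 < ξ ∧ ξ < s) ∧ deriv u ξ = (u s - u 0) / (s - 0) := by
    intro s
    by_cases hs : 0 < s
    · obtain ⟨ξ, hξ, h⟩ := exists_deriv_eq_slope u hs
        (fun x hx => (hu x hx.1).continuousAt.continuousWithinAt)
        (fun x hx => (hu x hx.1.le).differentiableWithinAt)
      exact ⟨ξ, fun _ => ⟨hξ, h⟩⟩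
    · exact ⟨0, fun h => absurd h hs⟩
  choose ξ hξ using hmvt
  have hpos : ∀ᶠ s : ℝ in 𝓝[>] 0, 0 < s := eventually_mem_nhdsWithin
  have hid : Tendsto (fun s : ℝ => s) (𝓝[>] 0) (𝓝 0) := nhdsWithin_le_nhds
  have hξ0 : Tendsto ξ (𝓝[>] 0) (𝓝 0) :=
    tendsto_of_tendsto_of_tendsto_of_le_of_le' tendsto_const_nhds hid
      (hpos.mono fun s hs => (hξ s hs).1.1.le) (hpos.mono fun s hs => (hξ s hs).1.2.le)
  have hslope : Tendsto (fun s => (u s - u 0) / (s - 0)) (𝓝[>] 0) (𝓝 (deriv u 0)) := by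
    have h := (hasDerivAt_iff_tendsto_slope.1 (hu 0 le_rfl).hasDerivAt).mono_left
      (nhdsWithin_mono 0 fun x (hx : 0 < x) => hx.ne')
    exact h.congr fun s => slope_def_field u 0 s
  have hlim : Tendsto (fun s => (ξ s) ^ 2 * ((u s - u 0) / (s - 0)) + I (ξ s))
      (𝓝[>] 0) (𝓝 (0 ^ 2 * deriv u 0 + I 0)) :=
    ((hξ0.pow 2).mul hslope).add ((hIc.tendsto 0).comp hξ0)
  have hP1 : P 1 = 0 := by
    have h : Tendsto (fun _ : ℝ => P 1) (𝓝[>] 0) (𝓝 (0 ^ 2 * deriv u 0 + I 0)) := by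
      refine hlim.congr' (hpos.mono fun s hs => ?_)
      rw [← (hξ s hs).2, ← hPc (ξ s) (hξ s hs).1.1]
    have := tendsto_nhds_unique tendsto_const_nhds h
    simpa [hI] using this
  rcases ht.eq_or_lt with rfl | ht
  · simp
  · have := hPc t ht
    rw [hP1] at this
    simp only [hP] at this
    linarith

lemma continuousOn_deriv_of_radial_ode {u g : ℝ → ℝ} (hg : Continuous g)
    (hu : ∀ t : ℝ, 0 ≤ t → DifferentiableAt ℝ u t) (hu0 : deriv u 0 = 0)
    (hu' : ∀ t : ℝ, 0 < t → DifferentiableAt ℝ (deriv u) t)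
    (hode : ∀ t : ℝ, 0 < t → deriv (deriv u) t + (2 / t) * deriv u t + g t = 0) :
    ContinuousOn (deriv u) (Ici 0) := by
  intro t ht
  rcases (mem_Ici.1 ht).eq_or_lt with rfl | ht
  swap
  · exact (hu' t ht).continuousAt.continuousWithinAt
  obtain ⟨M, hM⟩ := (isCompact_Icc (a := (0 : ℝ)) (b := 1)).exists_bound_of_continuousOn
    hg.continuousOn
  rw [ContinuousWithinAt, hu0]
  have hbound : ∀ᶠ s : ℝ in 𝓝[≥] 0, ‖deriv u s‖ ≤ M * s := by
    filter_upwards [Icc_mem_nhdsGE (zero_lt_one' ℝ)] with s hs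
    rcases hs.1.eq_or_lt with rfl | hs0
    · simp [hu0]
    have h := sq_mul_deriv_eq_neg_integral hg hu hu' hode hs.1
    have h2 : ‖∫ r in (0 : ℝ)..s, r ^ 2 * g r‖ ≤ s ^ 2 * M * |s - 0| := by
      refine intervalIntegral.norm_integral_le_of_norm_le_const fun r hr => ?_
      rw [uIoc_of_le hs.1] at hr
      rw [norm_mul, Real.norm_of_nonneg (sq_nonneg r)]
      have := hM r ⟨hr.1.le, hr.2.trans hs.2⟩
      have hr0 := hr.1.le
      have hrs := hr.2
      gcongr
    rw [← norm_neg, ← h, norm_mul, Real.norm_of_nonneg (sq_nonneg s), sub_zero,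
      abs_of_pos hs0] at h2
    refine le_of_mul_le_mul_left ?_ (pow_pos hs0 2)
    linarith
  refine squeeze_zero_norm' hbound ?_
  have : Tendsto (fun s : ℝ => M * s) (𝓝 0) (𝓝 (M * 0)) := (continuous_const_mul M).tendsto 0
  rw [mul_zero] at this
  exact this.mono_left nhdsWithin_le_nhds

lemma IsSolution.continuousOn {b : ℝ} {y : ℝ → ℝ} (hy : IsSolution b y) :
    ContinuousOn y (Ici 0) :=
  fun t ht => (hy.2.2.1 t ht).continuousAt.continuousWithinAt

lemma IsVariation.continuousOn {y δ : ℝ → ℝ} (hδ : IsVariation y δ) :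
    ContinuousOn δ (Ici 0) :=
  fun t ht => (hδ.2.2.1 t ht).continuousAt.continuousWithinAt

lemma IsSolution.continuousOn_deriv {b : ℝ} {y : ℝ → ℝ} (hy : IsSolution b y) :
    ContinuousOn (deriv y) (Ici 0) := by
  have hc := hy.continuousOn
  obtain ⟨-, h0, h1, h2, h3⟩ := hy
  have hg : ContinuousOn (fun s => y s ^ 3 - y s) (Ici 0) := by fun_prop
  refine continuousOn_deriv_of_radial_ode (continuous_comp_max_zero hg) h1 h0 h2 fun t ht => ?_
  simpa [max_eq_left ht.le] using h3 t ht

lemma IsSolution.antitoneOn_energy {b : ℝ} {y : ℝ → ℝ} (hy : IsSolution b y) :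
    AntitoneOn (energy y) (Ici 0) := by
  have hc := hy.continuousOn
  have hc' := hy.continuousOn_deriv
  obtain ⟨-, -, h1, h2, h3⟩ := hy
  have hd : ∀ t, 0 < t → HasDerivAt (energy y) (-(2 / t) * deriv y t ^ 2) t := by
    intro t ht
    have hy1 := (h1 t ht.le).hasDerivAt
    have h := ((((h2 t ht).hasDerivAt.pow 2).const_mul (1 / 2 : ℝ)).add
      ((hy1.pow 4).const_mul (1 / 4 : ℝ))).sub ((hy1.pow 2).const_mul (1 / 2 : ℝ))
    refine h.congr_deriv ?_
    have : deriv (deriv y) t = -(2 / t) * deriv y t - (y t ^ 3 - y t) := by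
      linarith [h3 t ht]
    rw [this]
    push_cast
    ring
  refine antitoneOn_of_deriv_nonpos (convex_Ici 0) ?_ ?_ ?_
  · unfold energy
    fun_prop
  · rw [interior_Ici]
    exact fun t ht => (hd t ht).differentiableAt.differentiableWithinAt
  · rw [interior_Ici]
    intro t ht
    rw [(hd t ht).deriv]
    have : 0 ≤ 2 / t := div_nonneg zero_le_two (mem_Ioi.1 ht).le
    nlinarith [mul_nonneg this (sq_nonneg (deriv y t))]

lemma IsSolution.sq_le {b : ℝ} (hb : 2 ≤ b ^ 2) {y : ℝ → ℝ} (hy : IsSolution b y) {t : ℝ}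
    (ht : 0 ≤ t) : y t ^ 2 ≤ b ^ 2 := by
  have h := hy.antitoneOn_energy (mem_Ici.2 le_rfl) (mem_Ici.2 ht) ht
  simp only [energy, hy.1, hy.2.1] at h
  by_contra! hlt
  nlinarith [sq_nonneg (deriv y t)]

lemma IsVariation.continuousOn_deriv {b : ℝ} {y δ : ℝ → ℝ} (hy : IsSolution b y)
    (hδ : IsVariation y δ) : ContinuousOn (deriv δ) (Ici 0) := by
  have hc := hy.continuousOn
  have hcδ := hδ.continuousOn
  obtain ⟨-, h0, h1, h2, h3⟩ := hδ
  have hg : ContinuousOn (fun s => (3 * y s ^ 2 - 1) * δ s) (Ici 0) := by fun_prop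
  refine continuousOn_deriv_of_radial_ode (continuous_comp_max_zero hg) h1 h0 h2 fun t ht => ?_
  simpa [max_eq_left ht.le] using h3 t ht

lemma ContinuousOn.intervalIntegrable_of_Ici {f : ℝ → ℝ} (hf : ContinuousOn f (Ici 0)) {t : ℝ}
    (ht : 0 ≤ t) : IntervalIntegrable f MeasureTheory.volume 0 t :=
  (hf.mono Icc_subset_Ici_self).intervalIntegrable_of_Icc ht

lemma IsVariation.abs_sub_one_le {b : ℝ} {y δ : ℝ → ℝ} (hy : IsSolution b y)
    (hδ : IsVariation y δ) {t : ℝ} (ht : 0 ≤ t) :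
    |δ t - 1| ≤ ∫ s in (0 : ℝ)..t, |deriv δ s| := by
  have h := intervalIntegral.integral_eq_sub_of_hasDerivAt
    (fun s hs => (hδ.2.2.1 s (by rw [uIcc_of_le ht] at hs; exact hs.1)).hasDerivAt)
    ((hδ.continuousOn_deriv hy).intervalIntegrable_of_Ici ht)
  rw [hδ.1] at h
  rw [← h]
  exact intervalIntegral.abs_integral_le_integral_abs ht

lemma IsVariation.abs_deriv_le {b : ℝ} (hb : 2 ≤ b ^ 2) {y δ : ℝ → ℝ} (hy : IsSolution b y)
    (hδ : IsVariation y δ) {t : ℝ} (ht : 0 ≤ t) :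
    |deriv δ t| ≤ t * b ^ 2 + 3 * b ^ 2 * ∫ s in (0 : ℝ)..t, |δ s - 1| := by
  have hc := hy.continuousOn
  have hcδ := hδ.continuousOn
  have hsq := fun s (hs : 0 ≤ s) => hy.sq_le hb hs
  obtain ⟨-, h0, h1, h2, h3⟩ := hδ
  rcases ht.eq_or_lt with rfl | htpos
  · simp [h0]
  have hg : ContinuousOn (fun s => (3 * y s ^ 2 - 1) * δ s) (Ici 0) := by fun_prop
  have h := sq_mul_deriv_eq_neg_integral (continuous_comp_max_zero hg) h1 h2
    (fun t ht => by simpa [max_eq_left ht.le] using h3 t ht) ht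
  have hcd : ContinuousOn (fun s => |δ s - 1|) (Ici 0) := by fun_prop
  have hle : ‖∫ s in (0 : ℝ)..t, s ^ 2 * ((3 * y (max s 0) ^ 2 - 1) * δ (max s 0))‖ ≤
      ∫ s in (0 : ℝ)..t, (3 * b ^ 2 * s ^ 2 + 3 * b ^ 2 * t ^ 2 * |δ s - 1|) := by
    refine intervalIntegral.norm_integral_le_of_norm_le ht
      (Eventually.of_forall fun s hs => ?_)
      (ContinuousOn.intervalIntegrable_of_Ici (by fun_prop) ht)
    rw [max_eq_left hs.1.le, norm_mul, norm_mul, Real.norm_of_nonneg (sq_nonneg s),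
      Real.norm_eq_abs, Real.norm_eq_abs]
    have hA : |3 * y s ^ 2 - 1| ≤ 3 * b ^ 2 := by
      rw [abs_le]
      constructor <;> nlinarith [hsq s hs.1.le, sq_nonneg (y s)]
    have hB : |δ s| ≤ 1 + |δ s - 1| := by
      simpa using abs_add_le 1 (δ s - 1)
    have hst : s ^ 2 ≤ t ^ 2 := pow_le_pow_left₀ hs.1.le hs.2 2
    calc s ^ 2 * (|3 * y s ^ 2 - 1| * |δ s|) ≤ s ^ 2 * (3 * b ^ 2 * (1 + |δ s - 1|)) := by gcongr
      _ = 3 * b ^ 2 * s ^ 2 + 3 * b ^ 2 * s ^ 2 * |δ s - 1| := by ring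
      _ ≤ 3 * b ^ 2 * s ^ 2 + 3 * b ^ 2 * t ^ 2 * |δ s - 1| := by gcongr
  rw [intervalIntegral.integral_add (Continuous.intervalIntegrable (by fun_prop) _ _)
      ((hcd.intervalIntegrable_of_Ici ht).const_mul _), intervalIntegral.integral_const_mul,
    intervalIntegral.integral_const_mul, integral_pow, ← norm_neg, ← h, norm_mul,
    Real.norm_of_nonneg (sq_nonneg t), Real.norm_eq_abs] at hle
  refine le_of_mul_le_mul_left (hle.trans_eq ?_) (pow_pos htpos 2)
  norm_num
  ring

/-- Grönwall's inequality in integral form with a linear inhomogeneity. -/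
lemma le_exp_sub_one_of_le_linear_add_integral {h : ℝ → ℝ} {c μ : ℝ} (hμ : 0 < μ)
    (hh : ContinuousOn h (Ici 0))
    (hle : ∀ t : ℝ, 0 ≤ t → h t ≤ t * c + μ * ∫ s in (0 : ℝ)..t, h s) {t : ℝ} (ht : 0 ≤ t) :
    h t ≤ c / μ * (Real.exp (μ * t) - 1) := by
  have hcont := continuous_comp_max_zero hh
  set H : ℝ → ℝ := fun t => ∫ s in (0 : ℝ)..t, h (max s 0) with hH
  have hHeq : ∀ t, 0 ≤ t → ∫ s in (0 : ℝ)..t, h s = H t := by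
    intro t ht
    refine intervalIntegral.integral_congr fun s hs => ?_
    rw [uIcc_of_le ht] at hs
    simp only [max_eq_left hs.1]
  have hHd : ∀ t, HasDerivAt H (h (max t 0)) t := fun t =>
    (hcont.integral_hasStrictDerivAt 0 t).hasDerivAt
  set V : ℝ → ℝ := fun t => c / μ ^ 2 * (Real.exp (μ * t) - 1) - t * (c / μ) with hV
  set F : ℝ → ℝ := fun t => Real.exp (-μ * t) * (H t - V t) with hF
  have hexp : ∀ a t : ℝ, HasDerivAt (fun t => Real.exp (a * t)) (Real.exp (a * t) * a) t :=
    fun a t => by simpa using ((hasDerivAt_id t).const_mul a).exp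
  have hVd : ∀ t, HasDerivAt V (t * c + μ * V t) t := by
    intro t
    have := (((hexp μ t).sub_const 1).const_mul (c / μ ^ 2)).sub
      ((hasDerivAt_id t).mul_const (c / μ))
    refine this.congr_deriv ?_
    simp only [hV]
    field_simp
    ring
  have hFd : ∀ t, HasDerivAt F
      (Real.exp (-μ * t) * (h (max t 0) - (t * c + μ * H t))) t := by
    intro t
    refine ((hexp (-μ) t).mul ((hHd t).sub (hVd t))).congr_deriv ?_
    simp only [Pi.sub_apply]
    ring
  have hanti : AntitoneOn F (Ici 0) := by
    refine antitoneOn_of_deriv_nonpos (convex_Ici 0)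
      (fun t _ => (hFd t).continuousAt.continuousWithinAt)
      (fun t _ => (hFd t).differentiableAt.differentiableWithinAt) fun t ht => ?_
    rw [interior_Ici] at ht
    have ht0 : 0 ≤ t := (mem_Ioi.1 ht).le
    rw [(hFd t).deriv, max_eq_left ht0]
    have := hle t ht0
    rw [hHeq t ht0] at this
    exact mul_nonpos_of_nonneg_of_nonpos (Real.exp_nonneg _) (by linarith)
  have hF0 : F 0 = 0 := by simp [hF, hH, hV]
  have hFt : F t ≤ 0 := hF0 ▸ hanti (mem_Ici.2 le_rfl) (mem_Ici.2 ht) ht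
  have hHV : H t ≤ V t := by
    by_contra! hlt
    exact absurd hFt (not_le.2 (mul_pos (Real.exp_pos _) (sub_pos.2 hlt)))
  have h1 := hle t ht
  rw [hHeq t ht] at h1
  calc h t ≤ t * c + μ * H t := h1
    _ ≤ t * c + μ * V t := by gcongr
    _ = c / μ * (Real.exp (μ * t) - 1) := by
      simp only [hV]
      field_simp
      ring

theorem gronwall_variation (b : ℝ) (hb : Real.sqrt 2 ≤ b)
    (y δ : ℝ → ℝ) (hy : IsSolution b y) (hδ : IsVariation y δ) :
    (∀ t : ℝ, 0 ≤ t →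
      |deriv δ t| + (Real.sqrt 3 * b) * |δ t - 1| ≤
        t * b ^ 2 + (Real.sqrt 3 * b) *
          ∫ s in (0 : ℝ)..t, (|deriv δ s| + (Real.sqrt 3 * b) * |δ s - 1|)) ∧
    (∀ t : ℝ, 0 ≤ t →
      |deriv δ t| + (Real.sqrt 3 * b) * |δ t - 1| ≤
        (b ^ 2 / (Real.sqrt 3 * b)) * (Real.exp (Real.sqrt 3 * b * t) - 1)) ∧
    ∀ t : ℝ, 0 ≤ t → t ≤ Real.log 4 / (Real.sqrt 3 * b) → 0 ≤ δ t := by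
  have hb0 : 0 < b := (Real.sqrt_pos.2 zero_lt_two).trans_le hb
  have hb2 : 2 ≤ b ^ 2 := (Real.sqrt_le_left hb0.le).1 hb
  have hsqrt : Real.sqrt 3 ^ 2 = 3 := Real.sq_sqrt zero_le_three
  set μ := Real.sqrt 3 * b with hμ
  have hμ0 : 0 < μ := mul_pos (Real.sqrt_pos.2 zero_lt_three) hb0
  have hμ2 : μ ^ 2 = 3 * b ^ 2 := by rw [hμ, mul_pow, hsqrt]
  have hcδ := hδ.continuousOn
  have hcδ' := hδ.continuousOn_deriv hy
  have hc1 : ContinuousOn (fun s => |deriv δ s|) (Ici 0) := by fun_prop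
  have hc2 : ContinuousOn (fun s => μ * |δ s - 1|) (Ici 0) := by fun_prop
  have hint : ∀ t : ℝ, 0 ≤ t → |deriv δ t| + μ * |δ t - 1| ≤
      t * b ^ 2 + μ * ∫ s in (0 : ℝ)..t, (|deriv δ s| + μ * |δ s - 1|) := by
    intro t ht
    rw [intervalIntegral.integral_add (hc1.intervalIntegrable_of_Ici ht)
      (hc2.intervalIntegrable_of_Ici ht), intervalIntegral.integral_const_mul]
    have h1 := hδ.abs_deriv_le hb2 hy ht
    have h2 := mul_le_mul_of_nonneg_left (hδ.abs_sub_one_le hy ht) hμ0.le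
    rw [← hμ2] at h1
    linarith
  have hexp : ∀ t : ℝ, 0 ≤ t → |deriv δ t| + μ * |δ t - 1| ≤
      b ^ 2 / μ * (Real.exp (μ * t) - 1) := fun t ht =>
    le_exp_sub_one_of_le_linear_add_integral hμ0 (hc1.add hc2) hint ht
  refine ⟨hint, hexp, fun t ht htle => ?_⟩
  have hE : Real.exp (μ * t) ≤ 4 := by
    rw [← Real.le_log_iff_exp_le four_pos, mul_comm]
    exact (le_div_iff₀ hμ0).1 htle
  have hle : μ * |δ t - 1| ≤ μ * 1 := by
    calc μ * |δ t - 1| ≤ |deriv δ t| + μ * |δ t - 1| := le_add_of_nonneg_left (abs_nonneg _)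
      _ ≤ b ^ 2 / μ * (Real.exp (μ * t) - 1) := hexp t ht
      _ ≤ b ^ 2 / μ * 3 := by
        gcongr
        linarith
      _ = μ * 1 := by
        field_simp
        linarith
  linarith [(abs_le.1 (le_of_mul_le_mul_left hle hμ0)).1]
end
end

section
/- For every b ∈ ℝ there exists a unique function y : [0,∞) → ℝ that is continuously differentiable on [0,∞), twice continuously differentiable on (0,∞), satisfies ÿ(t) + (2/t)ẏ(t) + y(t)³ − y(t) = 0 for all t > 0, and satisfies y(0) = b, ẏ(0) = 0; equivalently, y is the unique continuous solution of the integral system y(t) = b + ∫₀ᵗ ẏ(s) ds, ẏ(t) = −∫₀ᵗ (s²/t²)(y(s)³ − y(s)) ds, and it is defined for all t ≥ 0. -/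
noncomputable section

/-- `y` is a classical solution on `[0,∞)` of
`y'' + (2/t) y' + (y^3 - y) = 0`, `y(0) = b`, `y'(0) = 0`:
it is `C¹` on `[0,∞)`, `C²` on `(0,∞)`, satisfies the ODE on `(0,∞)`,
and attains the initial data (the derivative at `0` being the right-hand
derivative). -/
def IsClassicalSolution (b : ℝ) (y : ℝ → ℝ) : Prop :=
  ContDiffOn ℝ 1 y (Set.Ici 0) ∧
  ContDiffOn ℝ 2 y (Set.Ioi 0) ∧
  y 0 = b ∧
  derivWithin y (Set.Ici 0) 0 = 0 ∧
  ∀ t : ℝ, 0 < t →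
    deriv (deriv y) t + (2 / t) * deriv y t + ((y t) ^ 3 - y t) = 0

/-- Contraction mapping in the space of functions bounded by a multiple of `exp (L t²)`. -/
theorem exists_continuous_eq_sub_integral (b : ℝ) {g : ℝ → ℝ} {L C : ℝ} (hL : 0 < L)
    (hg : Continuous g) (hlip : ∀ x y, |g x - g y| ≤ L * |x - y|) (hC : ∀ x, |g x| ≤ C) :
    ∃ y : ℝ → ℝ, Continuous y ∧
      ∀ t, y t = b - t ^ 2 * ∫ r in (0 : ℝ)..1, (r - r ^ 2) * g (y (t * r)) := by
  have hC0 : 0 ≤ C := (abs_nonneg _).trans (hC 0)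
  let Y : BoundedContinuousFunction ℝ ℝ → ℝ → ℝ := fun u t => Real.exp (L * t ^ 2) * u t
  have hY : ∀ u, Continuous (Y u) := fun u => by
    have := u.continuous
    fun_prop
  let A : BoundedContinuousFunction ℝ ℝ → ℝ → ℝ := fun u t =>
    b - t ^ 2 * ∫ r in (0 : ℝ)..1, (r - r ^ 2) * g (Y u (t * r))
  have hA : ∀ u, Continuous (A u) := fun u => by
    have hYu := hY u
    have : Continuous fun t : ℝ => ∫ r in (0 : ℝ)..1, (r - r ^ 2) * g (Y u (t * r)) := by
      apply intervalIntegral.continuous_parametric_intervalIntegral_of_continuous'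
      simp only [Function.uncurry_def]
      fun_prop
    fun_prop
  have hbound : ∀ u t, ‖Real.exp (-(L * t ^ 2)) * A u t‖ ≤ |b| + C / L := by
    intro u t
    have hI : ‖∫ r in (0 : ℝ)..1, (r - r ^ 2) * g (Y u (t * r))‖ ≤ C * |1 - 0| := by
      apply intervalIntegral.norm_integral_le_of_norm_le_const
      intro r hr
      rw [Set.uIoc_of_le zero_le_one] at hr
      rw [Real.norm_eq_abs, abs_mul]
      have h1 : |r - r ^ 2| ≤ 1 := by
        rw [abs_le]; constructor <;> nlinarith [hr.1, hr.2]
      calc |r - r ^ 2| * |g (Y u (t * r))| ≤ 1 * C := by gcongr; exact hC _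
        _ = C := one_mul C
    rw [sub_zero, abs_one, mul_one, Real.norm_eq_abs] at hI
    have hAu : |A u t| ≤ |b| + t ^ 2 * C := by
      refine (abs_sub _ _).trans ?_
      rw [abs_mul, abs_of_nonneg (sq_nonneg t)]
      gcongr
    have hexp : 1 + L * t ^ 2 ≤ Real.exp (L * t ^ 2) := by
      linarith [Real.add_one_le_exp (L * t ^ 2)]
    have hLt : 0 ≤ L * t ^ 2 := by positivity
    rw [Real.norm_eq_abs, abs_mul, abs_of_pos (Real.exp_pos _), Real.exp_neg,
      inv_mul_le_iff₀ (Real.exp_pos _)]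
    calc |A u t| ≤ |b| + t ^ 2 * C := hAu
      _ ≤ (1 + L * t ^ 2) * (|b| + C / L) := by
        have h1 : (1 + L * t ^ 2) * (|b| + C / L)
            = |b| + t ^ 2 * C + (L * t ^ 2 * |b| + C / L) := by field_simp; ring
        have : 0 ≤ L * t ^ 2 * |b| + C / L := by positivity
        linarith
      _ ≤ Real.exp (L * t ^ 2) * (|b| + C / L) := by gcongr
  let Φ : BoundedContinuousFunction ℝ ℝ → BoundedContinuousFunction ℝ ℝ := fun u =>
    BoundedContinuousFunction.ofNormedAddCommGroup
      (fun t => Real.exp (-(L * t ^ 2)) * A u t)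
      (by have := hA u; fun_prop) (|b| + C / L) (hbound u)
  have hΦ : ContractingWith (1 / 2) Φ := by
    refine ⟨by rw [← NNReal.coe_lt_coe]; norm_num, LipschitzWith.of_dist_le_mul fun u v => ?_⟩
    rw [BoundedContinuousFunction.dist_le (by positivity)]
    intro t
    have hYu := hY u
    have hYv := hY v
    set d := dist u v
    have hd0 : 0 ≤ d := dist_nonneg
    have hF : ∫ r in (0 : ℝ)..1, Real.exp (L * t ^ 2 * r ^ 2) * (L * t ^ 2 * (2 * r))
        = Real.exp (L * t ^ 2) - 1 := by
      rw [intervalIntegral.integral_eq_sub_of_hasDerivAt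
        (f := fun r => Real.exp (L * t ^ 2 * r ^ 2))]
      · simp
      · intro r _
        have := (((hasDerivAt_id r).pow 2).const_mul (L * t ^ 2)).exp
        simpa using this
      · exact Continuous.intervalIntegrable (by fun_prop) _ _
    have hAdiff : |A u t - A v t| ≤ (1 / 2 * d) * (Real.exp (L * t ^ 2) - 1) := by
      have h1 : A u t - A v t = - ∫ r in (0 : ℝ)..1,
          t ^ 2 * ((r - r ^ 2) * (g (Y u (t * r)) - g (Y v (t * r)))) := by
        simp only [A]
        rw [intervalIntegral.integral_const_mul]
        simp only [mul_sub]
        rw [intervalIntegral.integral_sub]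
        · ring
        · exact Continuous.intervalIntegrable (by fun_prop) _ _
        · exact Continuous.intervalIntegrable (by fun_prop) _ _
      rw [h1, abs_neg, ← hF, ← intervalIntegral.integral_const_mul, ← Real.norm_eq_abs]
      refine intervalIntegral.norm_integral_le_of_norm_le zero_le_one ?_
        (Continuous.intervalIntegrable (by fun_prop) _ _)
      refine Filter.Eventually.of_forall fun r hr => ?_
      have h2 : |g (Y u (t * r)) - g (Y v (t * r))|
          ≤ L * (Real.exp (L * t ^ 2 * r ^ 2) * d) := by
        refine (hlip _ _).trans ?_
        simp only [Y]
        rw [← mul_sub, abs_mul, abs_of_pos (Real.exp_pos _), mul_pow, ← mul_assoc L (t ^ 2)]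
        gcongr
        exact BoundedContinuousFunction.dist_coe_le_dist (f := u) (g := v) (t * r)
      have h3 : |r - r ^ 2| ≤ r := by
        rw [abs_le]; constructor <;> nlinarith [hr.1, hr.2]
      rw [Real.norm_eq_abs, abs_mul, abs_mul, abs_of_nonneg (sq_nonneg t)]
      calc t ^ 2 * (|r - r ^ 2| * |g (Y u (t * r)) - g (Y v (t * r))|)
          ≤ t ^ 2 * (r * (L * (Real.exp (L * t ^ 2 * r ^ 2) * d))) := by
            gcongr
            exact hr.1.le
        _ = _ := by ring
    have h4 : dist (Φ u t) (Φ v t) = (Real.exp (L * t ^ 2))⁻¹ * |A u t - A v t| := by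
      simp only [Φ, BoundedContinuousFunction.coe_ofNormedAddCommGroup, Real.dist_eq]
      rw [← mul_sub, abs_mul, abs_of_pos (Real.exp_pos _), Real.exp_neg]
    rw [h4, inv_mul_le_iff₀ (Real.exp_pos _)]
    push_cast
    nlinarith
  obtain ⟨u, hu⟩ : ∃ u, Φ u = u := ⟨_, hΦ.fixedPoint_isFixedPt⟩
  refine ⟨Y u, hY u, fun t => ?_⟩
  have hut : Real.exp (-(L * t ^ 2)) * A u t = u t := DFunLike.congr_fun hu t
  change Real.exp (L * t ^ 2) * u t = A u t
  rw [← hut, ← mul_assoc, ← Real.exp_add]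
  simp

theorem continuous_integral_mul_comp_mul {h p : ℝ → ℝ} (hh : Continuous h) (hp : Continuous p) :
    Continuous fun t : ℝ => ∫ r in (0 : ℝ)..1, p r * h (t * r) := by
  apply intervalIntegral.continuous_parametric_intervalIntegral_of_continuous'
  simp only [Function.uncurry_def]
  fun_prop

theorem pow_mul_integral_comp_mul (h : ℝ → ℝ) (n : ℕ) (t : ℝ) :
    t ^ (n + 1) * ∫ r in (0 : ℝ)..1, r ^ n * h (t * r) = ∫ s in (0 : ℝ)..t, s ^ n * h s := by
  have := intervalIntegral.mul_integral_comp_mul_left (f := fun s => s ^ n * h s)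
    (a := 0) (b := 1) (c := t)
  rw [mul_zero, mul_one] at this
  rw [← this, pow_succ', mul_assoc, ← intervalIntegral.integral_const_mul]
  congr 2
  ext r
  ring

/-- The solution of `v' + (2/t) v = -h` that is regular at `0`. -/
def radialVelocity (h : ℝ → ℝ) (t : ℝ) : ℝ := -(t * ∫ r in (0 : ℝ)..1, r ^ 2 * h (t * r))

theorem continuous_radialVelocity {h : ℝ → ℝ} (hh : Continuous h) :
    Continuous (radialVelocity h) :=
  (continuous_id.mul (continuous_integral_mul_comp_mul hh (continuous_pow 2))).neg

theorem radialVelocity_of_ne_zero (h : ℝ → ℝ) {t : ℝ} (ht : t ≠ 0) :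
    radialVelocity h t = -(∫ s in (0 : ℝ)..t, s ^ 2 * h s) / t ^ 2 := by
  rw [radialVelocity, ← pow_mul_integral_comp_mul h 2 t]
  field_simp
  ring

theorem hasDerivAt_integral_pow_mul {h : ℝ → ℝ} (hh : Continuous h) (n : ℕ) (t : ℝ) :
    HasDerivAt (fun t => ∫ s in (0 : ℝ)..t, s ^ n * h s) (t ^ n * h t) t := by
  have : Continuous fun s => s ^ n * h s := by fun_prop
  exact this.integral_hasStrictDerivAt 0 t |>.hasDerivAt

theorem hasDerivAt_radialVelocity {h : ℝ → ℝ} (hh : Continuous h) {t : ℝ} (ht : t ≠ 0) :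
    HasDerivAt (radialVelocity h) (-h t - 2 / t * radialVelocity h t) t := by
  have h1 := (hasDerivAt_integral_pow_mul hh 2 t).neg.div (hasDerivAt_pow 2 t) (pow_ne_zero 2 ht)
  refine (h1.congr_of_eventuallyEq ?_).congr_deriv ?_
  · filter_upwards [isOpen_ne.mem_nhds ht] with s hs using radialVelocity_of_ne_zero h hs
  · rw [radialVelocity_of_ne_zero h ht]
    simp only [Pi.neg_apply]
    field_simp
    ring

theorem hasDerivAt_of_eq_sub_integral {h y : ℝ → ℝ} {b : ℝ} (hh : Continuous h)
    (hy : ∀ t, y t = b - t ^ 2 * ∫ r in (0 : ℝ)..1, (r - r ^ 2) * h (t * r)) (t : ℝ) :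
    HasDerivAt y (radialVelocity h t) t := by
  have hyc : Continuous y := by
    have := continuous_integral_mul_comp_mul hh (p := fun r => r - r ^ 2) (by fun_prop)
    rw [funext hy]
    fun_prop
  have hne : ∀ t, t ≠ 0 → HasDerivAt y (radialVelocity h t) t := by
    intro t ht
    have hrep : ∀ s, s ≠ 0 → y s = b - ((∫ r in (0 : ℝ)..s, r ^ 1 * h r)
        - (∫ r in (0 : ℝ)..s, r ^ 2 * h r) / s) := by
      intro s hs
      rw [hy, ← pow_mul_integral_comp_mul h 1 s, ← pow_mul_integral_comp_mul h 2 s]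
      simp only [sub_mul]
      rw [intervalIntegral.integral_sub
        (Continuous.intervalIntegrable (by fun_prop) _ _)
        (Continuous.intervalIntegrable (by fun_prop) _ _)]
      simp only [pow_one]
      field_simp
      ring
    have h1 := ((hasDerivAt_integral_pow_mul hh 1 t).sub
      ((hasDerivAt_integral_pow_mul hh 2 t).div (hasDerivAt_id t) ht)).const_sub b
    refine (h1.congr_of_eventuallyEq ?_).congr_deriv ?_
    · filter_upwards [isOpen_ne.mem_nhds ht] with s hs using hrep s hs
    · rw [radialVelocity_of_ne_zero h ht]
      simp only [id]
      field_simp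
      ring
  by_cases ht : t = 0
  · subst ht
    exact hasDerivAt_of_hasDerivAt_of_ne (fun s hs => hne s hs) hyc.continuousAt
      (continuous_radialVelocity hh).continuousAt
  · exact hne t ht

/-- The cubic nonlinearity frozen outside `[-M, M]`. -/
def truncatedCubic (M x : ℝ) : ℝ := (max (-M) (min M x)) ^ 3 - max (-M) (min M x)

theorem continuous_truncatedCubic (M : ℝ) : Continuous (truncatedCubic M) := by
  unfold truncatedCubic
  fun_prop

theorem truncatedCubic_of_abs_le {M x : ℝ} (hx : |x| ≤ M) : truncatedCubic M x = x ^ 3 - x := by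
  rw [abs_le] at hx
  rw [truncatedCubic, min_eq_right hx.2, max_eq_right hx.1]

theorem abs_clamp_le {M : ℝ} (hM : 0 ≤ M) (x : ℝ) : |max (-M) (min M x)| ≤ M :=
  abs_le.2 ⟨le_max_left _ _, max_le (by linarith) (min_le_left _ _)⟩

theorem abs_truncatedCubic_le {M : ℝ} (hM : 0 ≤ M) (x : ℝ) :
    |truncatedCubic M x| ≤ M ^ 3 + M := by
  have h := abs_clamp_le hM x
  refine (abs_sub _ _).trans ?_
  rw [abs_pow]
  gcongr

theorem abs_truncatedCubic_sub_le {M : ℝ} (hM : 0 ≤ M) (x y : ℝ) :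
    |truncatedCubic M x - truncatedCubic M y| ≤ (3 * M ^ 2 + 1) * |x - y| := by
  have hp := abs_clamp_le hM x
  have hq := abs_clamp_le hM y
  have hpq : |max (-M) (min M x) - max (-M) (min M y)| ≤ |x - y| := by
    rw [max_comm (-M), max_comm (-M), min_comm M, min_comm M]
    exact (abs_max_sub_max_le_abs _ _ _).trans (abs_inf_sub_inf_le_abs _ _ _)
  unfold truncatedCubic
  set p := max (-M) (min M x)
  set q := max (-M) (min M y)
  have h1 : |p ^ 2 + p * q + q ^ 2 - 1| ≤ 3 * M ^ 2 + 1 := by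
    rw [abs_le] at hp hq ⊢
    constructor <;> nlinarith
  calc |p ^ 3 - p - (q ^ 3 - q)| = |p ^ 2 + p * q + q ^ 2 - 1| * |p - q| := by
        rw [← abs_mul]; ring_nf
    _ ≤ _ := by gcongr

/-- The energy `v² / 2 + y⁴ / 4 - y² / 2` decreases as long as the truncation is inactive, which
keeps the solution in the region where it is inactive. -/
theorem abs_lt_of_truncated_solution {b : ℝ} {y v : ℝ → ℝ} (hy : ∀ t, HasDerivAt y (v t) t)
    (hv : Continuous v) (hv0 : v 0 = 0) (hy0 : y 0 = b)
    (hv' : ∀ t, 0 < t → HasDerivAt v (-truncatedCubic (|b| + 2) (y t) - 2 / t * v t) t)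
    {t : ℝ} (ht : 0 ≤ t) : |y t| < |b| + 2 := by
  by_contra! hcon
  have hyc : Continuous y := continuous_iff_continuousAt.2 fun t => (hy t).continuousAt
  have hcomp : IsCompact (Set.Icc 0 t ∩ {s | |b| + 2 ≤ |y s|}) :=
    isCompact_Icc.inter_right (isClosed_le continuous_const hyc.abs)
  obtain ⟨T, ⟨⟨hT0, hTt⟩, hT⟩, hmin⟩ := hcomp.exists_isLeast ⟨t, ⟨ht, le_rfl⟩, hcon⟩
  have hlt : ∀ s ∈ Set.Ioo 0 T, |y s| ≤ |b| + 2 := by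
    intro s hs
    by_contra! h
    exact absurd (hmin ⟨⟨hs.1.le, hs.2.le.trans hTt⟩, h.le⟩) (not_le.2 hs.2)
  have hE : ∀ s ∈ Set.Ioo 0 T, HasDerivAt
      (fun s => v s ^ 2 / 2 + (y s ^ 4 / 4 - y s ^ 2 / 2)) (-(2 / s * v s ^ 2)) s := by
    intro s hs
    refine ((((hv' s hs.1).pow 2).div_const 2).add
      ((((hy s).pow 4).div_const 4).sub (((hy s).pow 2).div_const 2))).congr_deriv ?_
    rw [truncatedCubic_of_abs_le (hlt s hs)]
    push_cast
    ring
  have hanti : AntitoneOn (fun s => v s ^ 2 / 2 + (y s ^ 4 / 4 - y s ^ 2 / 2)) (Set.Icc 0 T) := by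
    refine antitoneOn_of_hasDerivWithinAt_nonpos (convex_Icc 0 T)
      (Continuous.continuousOn (by fun_prop)) (f' := fun s => -(2 / s * v s ^ 2)) ?_ ?_
    · intro s hs
      rw [interior_Icc] at hs
      exact (hE s hs).hasDerivWithinAt
    · intro s hs
      rw [interior_Icc] at hs
      have := hs.1
      have : 0 ≤ 2 / s * v s ^ 2 := by positivity
      linarith
  have hle := hanti ⟨le_rfl, hT0⟩ ⟨hT0, le_rfl⟩ hT0
  simp only [hv0, hy0] at hle
  have hT' : |b| + 2 ≤ |y T| := hT
  have hb := abs_nonneg b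
  rw [← sq_abs b, ← (show Even 4 by decide).pow_abs b, ← sq_abs (y T),
    ← (show Even 4 by decide).pow_abs (y T)] at hle
  have hsq : |b| ^ 2 + 4 ≤ |y T| ^ 2 := by nlinarith
  nlinarith [sq_nonneg (v T), sq_nonneg |b|]

namespace IsClassicalSolution

variable {b : ℝ} {y : ℝ → ℝ}

theorem continuousOn_derivWithin (h : IsClassicalSolution b y) :
    ContinuousOn (derivWithin y (Set.Ici 0)) (Set.Ici 0) :=
  h.1.continuousOn_derivWithin (uniqueDiffOn_Ici 0) le_rfl

theorem hasDerivAt (h : IsClassicalSolution b y) {t : ℝ} (ht : 0 < t) :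
    HasDerivAt y (derivWithin y (Set.Ici 0) t) t := by
  rw [derivWithin_of_mem_nhds (Ici_mem_nhds ht)]
  exact ((h.1.contDiffAt (Ici_mem_nhds ht)).differentiableAt one_ne_zero).hasDerivAt

theorem hasDerivAt_derivWithin (h : IsClassicalSolution b y) {t : ℝ} (ht : 0 < t) :
    HasDerivAt (derivWithin y (Set.Ici 0))
      (-(2 / t * derivWithin y (Set.Ici 0) t + (y t ^ 3 - y t))) t := by
  have h2 : ContDiffOn ℝ 1 (deriv y) (Set.Ioi 0) :=
    h.2.1.deriv_of_isOpen isOpen_Ioi (by norm_num)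
  have h3 : HasDerivAt (deriv y) (deriv (deriv y) t) t :=
    ((h2.contDiffAt (Ioi_mem_nhds ht)).differentiableAt one_ne_zero).hasDerivAt
  refine (h3.congr_of_eventuallyEq ?_).congr_deriv ?_
  · filter_upwards [Ioi_mem_nhds ht] with s hs using derivWithin_of_mem_nhds (Ici_mem_nhds hs)
  · rw [derivWithin_of_mem_nhds (Ici_mem_nhds ht)]
    linarith [h.2.2.2.2 t ht]

/-- Grönwall's inequality for `w² + (w')²` with `w` the difference of two solutions: the singular
term only helps. -/
theorem eqOn {z : ℝ → ℝ} (hz : IsClassicalSolution b z) (hy : IsClassicalSolution b y) :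
    Set.EqOn z y (Set.Ici 0) := by
  intro T hT
  have hT0 : (0 : ℝ) ≤ T := hT
  have hsub : Set.Icc 0 T ⊆ Set.Ici (0 : ℝ) := Set.Icc_subset_Ici_self
  have cz := hz.1.continuousOn.mono hsub
  have cy := hy.1.continuousOn.mono hsub
  have cz' := hz.continuousOn_derivWithin.mono hsub
  have cy' := hy.continuousOn_derivWithin.mono hsub
  have hz0 := hz.2.2.2.1
  have hy0 := hy.2.2.2.1
  have dz := @hz.hasDerivAt
  have dy := @hy.hasDerivAt
  have dz' := @hz.hasDerivAt_derivWithin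
  have dy' := @hy.hasDerivAt_derivWithin
  generalize derivWithin z (Set.Ici 0) = z' at *
  generalize derivWithin y (Set.Ici 0) = y' at *
  obtain ⟨K, hK⟩ := isCompact_Icc.exists_bound_of_continuousOn
    (f := fun t => z t ^ 2 + z t * y t + y t ^ 2 - 1 - 1)
    (by fun_prop : ContinuousOn _ (Set.Icc 0 T))
  have hanti : AntitoneOn
      (fun t => Real.exp (-(K * t)) * ((z t - y t) ^ 2 + (z' t - y' t) ^ 2)) (Set.Icc 0 T) := by
    refine antitoneOn_of_hasDerivWithinAt_nonpos (convex_Icc 0 T) (by fun_prop)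
      (f' := fun t => Real.exp (-(K * t)) * (-K) * ((z t - y t) ^ 2 + (z' t - y' t) ^ 2)
        + Real.exp (-(K * t)) * (2 * (z t - y t) * (z' t - y' t) + 2 * (z' t - y' t) *
          (-(2 / t * z' t + (z t ^ 3 - z t)) - -(2 / t * y' t + (y t ^ 3 - y t))))) ?_ ?_
    · intro t ht
      rw [interior_Icc] at ht
      have h1 := ((hasDerivAt_id t).const_mul K).neg.exp
      have h2 := ((dz ht.1).sub (dy ht.1)).pow 2
      have h3 := ((dz' ht.1).sub (dy' ht.1)).pow 2
      refine ((h1.mul (h2.add h3)).congr_deriv ?_).hasDerivWithinAt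
      simp
    · intro t ht
      rw [interior_Icc] at ht
      have ht0 := ht.1
      have hq := hK t ⟨ht.1.le, ht.2.le⟩
      rw [Real.norm_eq_abs, abs_le] at hq
      have hs : 0 ≤ 4 / t * (z' t - y' t) ^ 2 := by positivity
      have hcross : -(2 * ((z t - y t) * (z' t - y' t)) *
          (z t ^ 2 + z t * y t + y t ^ 2 - 1 - 1)) ≤
          K * ((z t - y t) ^ 2 + (z' t - y' t) ^ 2) := by
        nlinarith [mul_nonneg (sub_nonneg.2 hq.2) (sq_nonneg (z t - y t - (z' t - y' t))),
          mul_nonneg (neg_le_iff_add_nonneg.1 hq.1) (sq_nonneg (z t - y t + (z' t - y' t)))]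
      have hkey : -K * ((z t - y t) ^ 2 + (z' t - y' t) ^ 2)
          + (2 * (z t - y t) * (z' t - y' t) + 2 * (z' t - y' t) *
          (-(2 / t * z' t + (z t ^ 3 - z t)) - -(2 / t * y' t + (y t ^ 3 - y t)))) ≤ 0 := by
        linear_combination hcross + hs
      rw [mul_assoc, ← mul_add]
      exact mul_nonpos_of_nonneg_of_nonpos (Real.exp_pos _).le hkey
  have hle := hanti ⟨le_rfl, hT0⟩ ⟨hT0, le_rfl⟩ hT0
  simp only [hz.2.2.1, hy.2.2.1, hz0, hy0, sub_self, ne_eq, OfNat.ofNat_ne_zero,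
    not_false_eq_true, zero_pow, add_zero, mul_zero] at hle
  have h0 := nonpos_of_mul_nonpos_right hle (Real.exp_pos _)
  have : (z T - y T) ^ 2 = 0 := by nlinarith [sq_nonneg (z T - y T), sq_nonneg (z' T - y' T)]
  exact sub_eq_zero.1 (pow_eq_zero_iff two_ne_zero |>.1 this)

end IsClassicalSolution

theorem isClassicalSolution_of_hasDerivAt {b : ℝ} {y v : ℝ → ℝ} (hy : ∀ t, HasDerivAt y (v t) t)
    (hv : Continuous v) (hv0 : v 0 = 0) (hy0 : y 0 = b)
    (hv' : ∀ t, 0 < t → HasDerivAt v (-(y t ^ 3 - y t) - 2 / t * v t) t) :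
    IsClassicalSolution b y := by
  have hyd : deriv y = v := funext fun t => (hy t).deriv
  have hyc : Continuous y := continuous_iff_continuousAt.2 fun t => (hy t).continuousAt
  have hv1 : ContDiffOn ℝ 1 v (Set.Ioi 0) := by
    rw [show (1 : WithTop ℕ∞) = 0 + 1 from (zero_add 1).symm,
      contDiffOn_succ_iff_deriv_of_isOpen isOpen_Ioi]
    refine ⟨fun t ht => (hv' t ht).differentiableAt.differentiableWithinAt, by simp, ?_⟩
    rw [contDiffOn_zero]
    have hc : ContinuousOn (fun t => -(y t ^ 3 - y t) - 2 / t * v t) (Set.Ioi 0) := by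
      have : ∀ t ∈ Set.Ioi (0 : ℝ), t ≠ 0 := fun t ht => ne_of_gt ht
      fun_prop (disch := assumption)
    exact hc.congr fun t ht => (hv' t ht).deriv
  refine ⟨?_, ?_, hy0, ?_, fun t ht => ?_⟩
  · exact (contDiff_one_iff_deriv.2
      ⟨fun t => (hy t).differentiableAt, hyd ▸ hv⟩).contDiffOn
  · rw [show (2 : WithTop ℕ∞) = 1 + 1 by norm_num,
      contDiffOn_succ_iff_deriv_of_isOpen isOpen_Ioi]
    exact ⟨fun t _ => (hy t).differentiableAt.differentiableWithinAt, by simp, hyd ▸ hv1⟩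
  · rw [(hy 0).hasDerivWithinAt.derivWithin (uniqueDiffOn_Ici 0 0 Set.self_mem_Ici), hv0]
  · rw [hyd, (hv' t ht).deriv]
    ring

theorem exists_unique_solution (b : ℝ) :
    ∃ y : ℝ → ℝ, IsClassicalSolution b y ∧
      (∀ t : ℝ, 0 ≤ t →
        y t = b + ∫ s in (0 : ℝ)..t, derivWithin y (Set.Ici 0) s) ∧
      (∀ t : ℝ, 0 < t →
        deriv y t = -∫ s in (0 : ℝ)..t, (s ^ 2 / t ^ 2) * ((y s) ^ 3 - y s)) ∧
      ∀ z : ℝ → ℝ, IsClassicalSolution b z → Set.EqOn z y (Set.Ici 0) := by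
  have hM : 0 ≤ |b| + 2 := by positivity
  obtain ⟨y, hyc, hyeq⟩ := exists_continuous_eq_sub_integral b (by positivity)
    (continuous_truncatedCubic (|b| + 2)) (abs_truncatedCubic_sub_le hM)
    (abs_truncatedCubic_le hM)
  set h : ℝ → ℝ := fun t => truncatedCubic (|b| + 2) (y t)
  have hhc : Continuous h := (continuous_truncatedCubic _).comp hyc
  have hy : ∀ t, HasDerivAt y (radialVelocity h t) t := hasDerivAt_of_eq_sub_integral hhc hyeq
  have hv := continuous_radialVelocity hhc
  have hv0 : radialVelocity h 0 = 0 := by simp [radialVelocity]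
  have hy0 : y 0 = b := by simpa using hyeq 0
  have hlt : ∀ t, 0 ≤ t → h t = y t ^ 3 - y t := fun t ht =>
    truncatedCubic_of_abs_le (abs_lt_of_truncated_solution hy hv hv0 hy0
      (fun s hs => hasDerivAt_radialVelocity hhc hs.ne') ht).le
  have hsol : IsClassicalSolution b y :=
    isClassicalSolution_of_hasDerivAt hy hv hv0 hy0 fun t ht =>
      hlt t ht.le ▸ hasDerivAt_radialVelocity hhc ht.ne'
  refine ⟨y, hsol, fun t ht => ?_, fun t ht => ?_, fun z hz => hz.eqOn hsol⟩
  · have hcongr : ∫ s in (0 : ℝ)..t, derivWithin y (Set.Ici 0) s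
        = ∫ s in (0 : ℝ)..t, radialVelocity h s := by
      refine intervalIntegral.integral_congr fun s hs => ?_
      rw [Set.uIcc_of_le ht] at hs
      exact (hy s).hasDerivWithinAt.derivWithin (uniqueDiffOn_Ici 0 s hs.1)
    rw [hcongr, intervalIntegral.integral_eq_sub_of_hasDerivAt (fun s _ => hy s)
      (hv.intervalIntegrable _ _), hy0]
    ring
  · rw [(hy t).deriv, radialVelocity_of_ne_zero h ht.ne', neg_div,
      ← intervalIntegral.integral_div]
    congr 1
    refine intervalIntegral.integral_congr fun s hs => ?_
    rw [Set.uIcc_of_le ht.le] at hs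
    simp only [hlt s hs.1]
    ring
end
end
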